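/- arXiv:1604.04318 — 2 statements merged into one kernel-verified Lean document; each statement's English description precedes it below -/
import Mathlib

section
/- Let x_1, …, x_n ∈ ℝ^d have arithmetic mean A = (1/n) Σ_{i=1}^n x_i, and for p ∈ ℝ^d let Σ_p := (1/n) Σ_{i=1}^n (x_i − p)(x_i − p)ᵀ. Then for every B ∈ ℝ^d and every 1 ≤ k ≤ d, the sum of the k largest eigenvalues of Σ_B is at most the sum of the k largest eigenvalues of Σ_A plus ‖B − A‖²: Σ_{j=1}^k λ_j(Σ_B) ≤ Σ_{j=1}^k λ_j(Σ_A) + ‖B − A‖². -/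
open Matrix

/-- A weighted sum with weights in `[0, 1]` of total mass `#s` is at most the sum over `s`,
when the values on `s` dominate those off `s`. -/
theorem sum_mul_le_sum_of_threshold {ι : Type*} [Fintype ι] (s : Finset ι) (t : ℝ) (c μ : ι → ℝ)
    (h_mem : ∀ i ∈ s, t ≤ μ i) (h_notMem : ∀ i ∉ s, μ i ≤ t)
    (c_nonneg : ∀ i, 0 ≤ c i) (c_le_one : ∀ i, c i ≤ 1) (c_sum : ∑ i, c i = s.card) :
    ∑ i, c i * μ i ≤ ∑ i ∈ s, μ i := by
  classical
  have key : ∑ i, c i * (μ i - t) ≤ ∑ i, if i ∈ s then μ i - t else 0 := by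
    refine Finset.sum_le_sum fun i _ => ?_
    split_ifs with hi
    · exact mul_le_of_le_one_left (sub_nonneg.2 (h_mem i hi)) (c_le_one i)
    · exact mul_nonpos_of_nonneg_of_nonpos (c_nonneg i) (sub_nonpos.2 (h_notMem i hi))
  simp only [mul_sub, Finset.sum_sub_distrib, ← Finset.sum_mul, c_sum, Finset.sum_ite_mem,
    Finset.univ_inter, Finset.sum_const, nsmul_eq_mul] at key
  linarith

/-- The rows of a real orthogonal matrix have unit length. -/
theorem sum_sq_row_eq_one {ι : Type*} [Fintype ι] [DecidableEq ι] {W : Matrix ι ι ℝ}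
    (hW : W * Wᵀ = 1) (i : ι) : ∑ l, W i l ^ 2 = 1 := by
  simpa [mul_apply, sq] using congr_fun₂ hW i i

/-- The diagonal of an orthogonal conjugate of `diagonal μ`, summed over `s`, is at most the sum of
`μ` over `s`, when the values of `μ` on `s` dominate those off `s`. -/
theorem sum_diag_conj_diagonal_le {ι : Type*} [Fintype ι] [DecidableEq ι] (s : Finset ι) (t : ℝ)
    (μ : ι → ℝ) (h_mem : ∀ i ∈ s, t ≤ μ i) (h_notMem : ∀ i ∉ s, μ i ≤ t)
    {W : Matrix ι ι ℝ} (hW : W * Wᵀ = 1) :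
    ∑ j ∈ s, (W * diagonal μ * Wᵀ) j j ≤ ∑ j ∈ s, μ j := by
  have hW' : Wᵀ * Wᵀᵀ = 1 := by rw [transpose_transpose]; exact mul_eq_one_comm.1 hW
  have diag_eq : ∑ j ∈ s, (W * diagonal μ * Wᵀ) j j = ∑ l, (∑ j ∈ s, W j l ^ 2) * μ l := by
    simp only [mul_apply (M := W * diagonal μ), mul_diagonal, transpose_apply, Finset.sum_mul]
    rw [Finset.sum_comm]
    exact Finset.sum_congr rfl fun l _ => Finset.sum_congr rfl fun j _ => by ring
  rw [diag_eq]
  refine sum_mul_le_sum_of_threshold s t _ μ h_mem h_notMem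
    (fun l => Finset.sum_nonneg fun j _ => sq_nonneg _) (fun l => ?_) ?_
  · rw [← sum_sq_row_eq_one hW' l]
    exact Finset.sum_le_sum_of_subset_of_nonneg s.subset_univ fun j _ _ => sq_nonneg _
  · rw [Finset.sum_comm]
    simp [sum_sq_row_eq_one hW]

/-- The second moment matrix about `B` is the covariance matrix plus a rank-one shift. -/
theorem sum_vecMulVec_sub_eq {ι : Type*} {n : ℕ} (hn : 0 < n) (x : Fin n → ι → ℝ) (A B : ι → ℝ)
    (hA : A = (n : ℝ)⁻¹ • ∑ i, x i) :
    (n : ℝ)⁻¹ • ∑ i, vecMulVec (x i - B) (x i - B)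
      = (n : ℝ)⁻¹ • ∑ i, vecMulVec (x i - A) (x i - A) + vecMulVec (B - A) (B - A) := by
  have hn' : (n : ℝ) ≠ 0 := by positivity
  refine Matrix.ext fun a b => ?_
  have coord (c : ι) : ∑ i, x i c = n * A c := by
    simp [hA, Finset.sum_apply, mul_inv_cancel_left₀ hn']
  simp only [Matrix.smul_apply, Matrix.sum_apply, Matrix.add_apply, vecMulVec_apply,
    Pi.sub_apply, smul_eq_mul, sub_mul, mul_sub, Finset.sum_sub_distrib, ← Finset.sum_mul,
    ← Finset.mul_sum, coord,
    Finset.sum_const, Finset.card_univ, Fintype.card_fin, nsmul_eq_mul]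
  field_simp
  ring

/-- For data `x 1, …, x n` in `ℝ^d` with mean `A` and covariance matrices
`Σ_p = (1/n) Σᵢ (xᵢ − p)(xᵢ − p)ᵀ`, the sum of the `k` largest eigenvalues of `Σ_B`
is at most the sum of the `k` largest eigenvalues of `Σ_A` plus `‖B − A‖²`.
Eigenvalues in decreasing order with multiplicity are encoded by antitone functions
together with orthogonal diagonalizations. -/
theorem stmt_4 {d n k : ℕ} (hn : 0 < n) (hk1 : 1 ≤ k) (hkd : k ≤ d)
    (x : Fin n → (Fin d → ℝ))
    (A : Fin d → ℝ) (hA : A = (n : ℝ)⁻¹ • ∑ i, x i) (B : Fin d → ℝ)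
    (SA SB : Matrix (Fin d) (Fin d) ℝ)
    (hSA : SA = (n : ℝ)⁻¹ • ∑ i, Matrix.vecMulVec (x i - A) (x i - A))
    (hSB : SB = (n : ℝ)⁻¹ • ∑ i, Matrix.vecMulVec (x i - B) (x i - B))
    (μ ν : Fin d → ℝ) (hμ : Antitone μ) (hν : Antitone ν)
    (U V : Matrix (Fin d) (Fin d) ℝ) (hU : U * Uᵀ = 1) (hV : V * Vᵀ = 1)
    (hAdec : SA = U * Matrix.diagonal μ * Uᵀ)
    (hBdec : SB = V * Matrix.diagonal ν * Vᵀ) :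
    ∑ j : Fin k, ν (Fin.castLE hkd j)
      ≤ ∑ j : Fin k, μ (Fin.castLE hkd j) + ∑ i, (B i - A i) ^ 2 := by
  have hV' : Vᵀ * V = 1 := mul_eq_one_comm.1 hV
  have hU' : Uᵀ * U = 1 := mul_eq_one_comm.1 hU
  have hW : (Vᵀ * U) * (Vᵀ * U)ᵀ = 1 := by
    rw [transpose_mul, transpose_transpose, Matrix.mul_assoc, ← Matrix.mul_assoc U, hU,
      Matrix.one_mul, hV']
  set w := Vᵀ *ᵥ (B - A) with hw
  have norm_w : ∑ j, w j ^ 2 = ∑ i, (B i - A i) ^ 2 := by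
    have : w ⬝ᵥ w = (B - A) ⬝ᵥ (B - A) := by
      rw [hw, dotProduct_mulVec, vecMul_transpose, mulVec_mulVec, hV, one_mulVec]
    simpa [dotProduct, sq] using this
  have diag : diagonal ν = (Vᵀ * U) * diagonal μ * (Vᵀ * U)ᵀ + vecMulVec w w := by
    have h := sum_vecMulVec_sub_eq hn x A B hA
    rw [← hSA, ← hSB, hAdec, hBdec] at h
    calc diagonal ν = Vᵀ * (V * diagonal ν * Vᵀ) * V := by
          simp only [Matrix.mul_assoc, hV', Matrix.mul_one]
          rw [← Matrix.mul_assoc, hV', Matrix.one_mul]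
      _ = _ := by
          rw [h, Matrix.mul_add, Matrix.add_mul, mul_vecMulVec, vecMulVec_mul, hw,
            ← mulVec_transpose]
          simp only [transpose_mul, transpose_transpose, Matrix.mul_assoc]
  let s : Finset (Fin d) := Finset.univ.map (Fin.castLEEmb hkd)
  have mem_s (i : Fin d) : i ∈ s ↔ (i : ℕ) < k := by
    simp only [s, Finset.mem_map, Finset.mem_univ, true_and]
    exact ⟨by rintro ⟨j, rfl⟩; exact j.2, fun h => ⟨⟨i, h⟩, rfl⟩⟩
  have sum_s (f : Fin d → ℝ) : ∑ j : Fin k, f (Fin.castLE hkd j) = ∑ i ∈ s, f i := by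
    simp [s]
  rw [sum_s, sum_s, ← norm_w]
  calc ∑ j ∈ s, ν j
      = ∑ j ∈ s, ((Vᵀ * U) * diagonal μ * (Vᵀ * U)ᵀ) j j + ∑ j ∈ s, w j ^ 2 := by
        rw [← Finset.sum_add_distrib]
        refine Finset.sum_congr rfl fun j _ => ?_
        simpa [vecMulVec_apply, sq] using congr_fun₂ diag j j
    _ ≤ ∑ j ∈ s, μ j + ∑ j, w j ^ 2 := by
        refine add_le_add (sum_diag_conj_diagonal_le s (μ ⟨k - 1, by omega⟩) μ
          (fun i hi => hμ ?_) (fun i hi => hμ ?_) hW)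
          (Finset.sum_le_sum_of_subset_of_nonneg s.subset_univ fun j _ _ => sq_nonneg _)
        · rw [mem_s] at hi
          exact Fin.le_def.2 (by simp only; omega)
        · rw [mem_s] at hi
          exact Fin.le_def.2 (by simp only; omega)
end

section
/- Let M be a real symmetric positive semidefinite d×d matrix with eigenvalues λ_1(M) ≥ … ≥ λ_d(M), let 1 ≤ k ≤ d, and let u_1, …, u_k be orthonormal eigenvectors of M with M u_j = λ_j(M) u_j for j = 1, …, k. If v ∈ ℝ^d lies in the linear span of {u_1, …, u_k}, then the sum of the k largest eigenvalues of M + vvᵀ equals Σ_{j=1}^k λ_j(M) + ‖v‖². -/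
open Matrix

/-- Bessel's inequality for a matrix with orthonormal rows. -/
theorem dotProduct_mulVec_self_le {m n : Type*} [Fintype m] [Fintype n] [DecidableEq m]
    {A : Matrix m n ℝ} (hA : A * Aᵀ = 1) (x : n → ℝ) : A *ᵥ x ⬝ᵥ A *ᵥ x ≤ x ⬝ᵥ x := by
  have hnonneg : 0 ≤ (x - Aᵀ *ᵥ (A *ᵥ x)) ⬝ᵥ (x - Aᵀ *ᵥ (A *ᵥ x)) :=
    Finset.sum_nonneg fun i _ => mul_self_nonneg _
  have hcross : x ⬝ᵥ Aᵀ *ᵥ (A *ᵥ x) = A *ᵥ x ⬝ᵥ A *ᵥ x := by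
    rw [dotProduct_mulVec, vecMul_transpose]
  have hsq : Aᵀ *ᵥ (A *ᵥ x) ⬝ᵥ Aᵀ *ᵥ (A *ᵥ x) = A *ᵥ x ⬝ᵥ A *ᵥ x := by
    rw [dotProduct_mulVec, vecMul_transpose, mulVec_mulVec, hA, one_mulVec]
  rw [sub_dotProduct, dotProduct_sub, dotProduct_sub, hsq,
    dotProduct_comm (Aᵀ *ᵥ (A *ᵥ x)) x, hcross] at hnonneg
  linarith

/-- A weighted sum of a decreasing sequence, with weights in `[0, 1]` of total mass `k`, is at most
the sum of its first `k` terms. -/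
theorem Antitone.sum_mul_le_sum_castLE {d k : ℕ} (hk : 1 ≤ k) (hkd : k ≤ d) {ν : Fin d → ℝ}
    (hν : Antitone ν) {c : Fin d → ℝ} (hc0 : ∀ i, 0 ≤ c i) (hc1 : ∀ i, c i ≤ 1)
    (hc : ∑ i, c i = k) : ∑ i, ν i * c i ≤ ∑ j : Fin k, ν (Fin.castLE hkd j) := by
  obtain ⟨e, rfl⟩ := Nat.exists_eq_add_of_le hkd
  let p : Fin (k + e) := ⟨k - 1, by omega⟩
  have hcast (j : Fin k) : Fin.castLE hkd j = Fin.castAdd e j := rfl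
  simp only [hcast]
  rw [Fin.sum_univ_add] at hc ⊢
  have hlow : ∑ j : Fin k, (ν (Fin.castAdd e j) - ν p) * c (Fin.castAdd e j)
      ≤ ∑ j : Fin k, (ν (Fin.castAdd e j) - ν p) := by
    refine Finset.sum_le_sum fun j _ => mul_le_of_le_one_right (sub_nonneg.2 (hν ?_)) (hc1 _)
    simp only [Fin.le_def, Fin.val_castAdd, p]
    omega
  have hhigh : ∑ j : Fin e, (ν (Fin.natAdd k j) - ν p) * c (Fin.natAdd k j) ≤ 0 := by
    refine Finset.sum_nonpos fun j _ =>
      mul_nonpos_of_nonpos_of_nonneg (sub_nonpos.2 (hν ?_)) (hc0 _)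
    simp only [Fin.le_def, Fin.val_natAdd, p]
    omega
  simp only [sub_mul, Finset.sum_sub_distrib, ← Finset.mul_sum, Finset.sum_const,
    Finset.card_univ, Fintype.card_fin, nsmul_eq_mul] at hlow hhigh
  linear_combination hlow + hhigh + ν p * hc

/-- **Ky Fan's inequality**: the trace of the compression of a symmetric matrix to `k` orthonormal
vectors is at most the sum of its `k` largest eigenvalues. -/
theorem trace_mul_mul_transpose_le_sum {d k : ℕ} (hk : 1 ≤ k) (hkd : k ≤ d) {ν : Fin d → ℝ}
    (hν : Antitone ν) {W N : Matrix (Fin d) (Fin d) ℝ} (hW : W * Wᵀ = 1)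
    (hN : N = W * diagonal ν * Wᵀ) {A : Matrix (Fin k) (Fin d) ℝ} (hA : A * Aᵀ = 1) :
    (A * N * Aᵀ).trace ≤ ∑ j : Fin k, ν (Fin.castLE hkd j) := by
  set B := A * W with hBdef
  have hB : B * Bᵀ = 1 := by
    rw [hBdef, transpose_mul, Matrix.mul_assoc, ← Matrix.mul_assoc W, hW, Matrix.one_mul, hA]
  have hcomp : A * N * Aᵀ = B * diagonal ν * Bᵀ := by
    simp only [hN, hBdef, transpose_mul, Matrix.mul_assoc]
  have htrace : (A * N * Aᵀ).trace = ∑ i, ν i * ∑ j, B j i * B j i := by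
    simp only [Finset.mul_sum]
    rw [hcomp, trace, Finset.sum_comm]
    refine Finset.sum_congr rfl fun j _ => ?_
    rw [diag_apply, mul_apply]
    refine Finset.sum_congr rfl fun i _ => ?_
    rw [mul_diagonal, transpose_apply]
    ring
  rw [htrace]
  refine hν.sum_mul_le_sum_castLE hk hkd
    (fun i => Finset.sum_nonneg fun j _ => mul_self_nonneg _) (fun i => ?_) ?_
  · have h := dotProduct_mulVec_self_le hB (Pi.single i 1)
    rwa [mulVec_single_one, single_one_dotProduct, Pi.single_eq_same] at h
  · rw [Finset.sum_comm]
    simpa [trace, mul_apply] using congrArg trace hB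

/-- The trace of the compression of `vvᵀ`. -/
theorem trace_mul_vecMulVec_mul_transpose {m n : Type*} [Fintype m] [Fintype n]
    (A : Matrix m n ℝ) (v : n → ℝ) :
    (A * vecMulVec v v * Aᵀ).trace = A *ᵥ v ⬝ᵥ A *ᵥ v := by
  rw [mul_vecMulVec, vecMulVec_mul, vecMul_transpose, trace_vecMulVec]

/-- Equality case of the rank-one perturbation bound: if `M` is real symmetric
positive semidefinite with eigenvalues `μ 0 ≥ μ 1 ≥ …` (decreasing, with
multiplicity), `u 0, …, u (k-1)` are orthonormal eigenvectors for the `k` largest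
eigenvalues, and `v` lies in their span, then the sum of the `k` largest
eigenvalues of `M + vvᵀ` equals `Σ_{j<k} μ j + ‖v‖²`. -/
theorem stmt_5 {d k : ℕ} (hk1 : 1 ≤ k) (hkd : k ≤ d)
    (M : Matrix (Fin d) (Fin d) ℝ) (hM : M.PosSemidef)
    (μ : Fin d → ℝ) (hμ : Antitone μ)
    (U : Matrix (Fin d) (Fin d) ℝ) (hU : U * Uᵀ = 1)
    (hMdec : M = U * Matrix.diagonal μ * Uᵀ)
    (u : Fin k → (Fin d → ℝ))
    (huortho : ∀ i j : Fin k, ∑ l, u i l * u j l = if i = j then 1 else 0)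
    (hueig : ∀ j : Fin k, M.mulVec (u j) = μ (Fin.castLE hkd j) • u j)
    (v : Fin d → ℝ) (hv : v ∈ Submodule.span ℝ (Set.range u))
    (ν : Fin d → ℝ) (hν : Antitone ν)
    (W : Matrix (Fin d) (Fin d) ℝ) (hW : W * Wᵀ = 1)
    (hPertdec : M + Matrix.vecMulVec v v = W * Matrix.diagonal ν * Wᵀ) :
    ∑ j : Fin k, ν (Fin.castLE hkd j)
      = ∑ j : Fin k, μ (Fin.castLE hkd j) + ∑ i, v i ^ 2 := by
  have hvv : ∑ i, v i ^ 2 = v ⬝ᵥ v := Finset.sum_congr rfl fun i _ => sq (v i)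
  rw [hvv]
  apply le_antisymm
  · have hWt : Wᵀ * W = 1 := mul_eq_one_comm.1 hW
    let A : Matrix (Fin k) (Fin d) ℝ := Wᵀ.submatrix (Fin.castLE hkd) id
    have hsub (N : Matrix (Fin d) (Fin d) ℝ) :
        A * N * Aᵀ = (Wᵀ * N * W).submatrix (Fin.castLE hkd) (Fin.castLE hkd) := rfl
    have hA : A * Aᵀ = 1 := by
      have h := hsub 1
      rwa [Matrix.mul_one, Matrix.mul_one, hWt,
        submatrix_one _ (Fin.castLE_injective hkd)] at h
    have hdiag : Wᵀ * (W * diagonal ν * Wᵀ) * W = diagonal ν := by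
      rw [Matrix.mul_assoc, Matrix.mul_assoc, Matrix.mul_assoc, hWt, Matrix.mul_one,
        ← Matrix.mul_assoc, hWt, Matrix.one_mul]
    have htrace : (A * (M + vecMulVec v v) * Aᵀ).trace = ∑ j : Fin k, ν (Fin.castLE hkd j) := by
      rw [hsub, hPertdec, hdiag]
      simp [trace]
    rw [← htrace, Matrix.mul_add, Matrix.add_mul, trace_add, trace_mul_vecMulVec_mul_transpose]
    exact add_le_add (trace_mul_mul_transpose_le_sum hk1 hkd hμ hU hMdec hA)
      (dotProduct_mulVec_self_le hA v)
  · let A : Matrix (Fin k) (Fin d) ℝ := Matrix.of u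
    have hA : A * Aᵀ = 1 := by
      ext i j
      simpa [A, mul_apply, one_apply] using huortho i j
    have hAM : (A * M * Aᵀ).trace = ∑ j : Fin k, μ (Fin.castLE hkd j) := by
      refine Finset.sum_congr rfl fun j _ => ?_
      have h : (A * M * Aᵀ) j j = u j ⬝ᵥ M *ᵥ u j := by
        rw [Matrix.mul_assoc]
        rfl
      rw [diag_apply, h, hueig, dotProduct_smul, dotProduct, huortho]
      simp
    have hAv : A *ᵥ v ⬝ᵥ A *ᵥ v = v ⬝ᵥ v := by
      obtain ⟨c, hc⟩ := (Submodule.mem_span_range_iff_exists_fun ℝ).1 hv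
      have hv' : v = Aᵀ *ᵥ c := by
        ext i
        simp [← hc, A, mulVec, dotProduct, mul_comm]
      have hAv' : A *ᵥ v = c := by rw [hv', mulVec_mulVec, hA, one_mulVec]
      calc A *ᵥ v ⬝ᵥ A *ᵥ v = v ⬝ᵥ Aᵀ *ᵥ c := by
            rw [dotProduct_mulVec v, vecMul_transpose, hAv']
        _ = v ⬝ᵥ v := by rw [← hv']
    rw [← hAM, ← hAv, ← trace_mul_vecMulVec_mul_transpose, ← trace_add, ← Matrix.add_mul,
      ← Matrix.mul_add]
    exact trace_mul_mul_transpose_le_sum hk1 hkd hν hW hPertdec hA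
end
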